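/- Let p, v ∈ [0,1] and let σ_v = v·(p·ρ_AB + (1−p)·I₄/4) + (1−v)·I₄/4 be the white-noise mixture of the post-depolarizing-channel maximally entangled state. Then tr[σ_v·𝔅] = 4√3·p·v, and consequently tr[σ_v·𝔅] ≤ 4 if and only if p·v ≤ 1/√3. In particular, for p > 1/√3 the largest admissible visibility is v* = 1/(√3·p), so the white-noise robustness equals 1 − 1/(√3·p). -/

import Mathlib

open Matrix Kronecker
open scoped ComplexOrder

noncomputable def σx : Matrix (Fin 2) (Fin 2) ℂ := !![0, 1; 1, 0]
noncomputable def σy : Matrix (Fin 2) (Fin 2) ℂ := !![0, -Complex.I; Complex.I, 0]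
noncomputable def σz : Matrix (Fin 2) (Fin 2) ℂ := !![1, 0; 0, -1]

/-- Bob's observables for the Elegant Bell inequality. -/
noncomputable def B1 : Matrix (Fin 2) (Fin 2) ℂ := (Real.sqrt 3 : ℂ)⁻¹ • (σx - σy + σz)
noncomputable def B2 : Matrix (Fin 2) (Fin 2) ℂ := (Real.sqrt 3 : ℂ)⁻¹ • (σx + σy - σz)
noncomputable def B3 : Matrix (Fin 2) (Fin 2) ℂ := (Real.sqrt 3 : ℂ)⁻¹ • (-σx - σy - σz)
noncomputable def B4 : Matrix (Fin 2) (Fin 2) ℂ := (Real.sqrt 3 : ℂ)⁻¹ • (-σx + σy + σz)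

/-- The EBI Bell operator 𝔅 with Alice's observables A₁ = σx, A₂ = σy, A₃ = σz. -/
noncomputable def EBIop : Matrix (Fin 2 × Fin 2) (Fin 2 × Fin 2) ℂ :=
  σx ⊗ₖ (B1 + B2 - B3 - B4) + σy ⊗ₖ (B1 - B2 + B3 - B4) + σz ⊗ₖ (B1 - B2 - B3 + B4)

/-- The maximally entangled two-qubit state. -/
noncomputable def ρAB : Matrix (Fin 2 × Fin 2) (Fin 2 × Fin 2) ℂ :=
  (4 : ℂ)⁻¹ • ((1 : Matrix (Fin 2) (Fin 2) ℂ) ⊗ₖ (1 : Matrix (Fin 2) (Fin 2) ℂ)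
    + σx ⊗ₖ σx - σy ⊗ₖ σy + σz ⊗ₖ σz)

/-- White-noise mixture (visibility `v`) of the maximally entangled state after a
depolarizing channel with parameter `p` acted on one qubit. -/
noncomputable def σv (p v : ℝ) : Matrix (Fin 2 × Fin 2) (Fin 2 × Fin 2) ℂ :=
  (v : ℂ) • ((p : ℂ) • ρAB + ((1 - p : ℝ) : ℂ) •
      ((4 : ℂ)⁻¹ • (1 : Matrix (Fin 2 × Fin 2) (Fin 2 × Fin 2) ℂ)))
    + ((1 - v : ℝ) : ℂ) • ((4 : ℂ)⁻¹ • (1 : Matrix (Fin 2 × Fin 2) (Fin 2 × Fin 2) ℂ))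

theorem EBIop_eq : EBIop =
    (4 * (Real.sqrt 3 : ℂ)⁻¹) • (σx ⊗ₖ σx - σy ⊗ₖ σy + σz ⊗ₖ σz) := by
  have hx : B1 + B2 - B3 - B4 = (4 * (Real.sqrt 3 : ℂ)⁻¹) • σx := by
    unfold B1 B2 B3 B4
    module
  have hy : B1 - B2 + B3 - B4 = -((4 * (Real.sqrt 3 : ℂ)⁻¹) • σy) := by
    unfold B1 B2 B3 B4
    module
  have hz : B1 - B2 - B3 + B4 = (4 * (Real.sqrt 3 : ℂ)⁻¹) • σz := by
    unfold B1 B2 B3 B4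
    module
  have hneg : σy ⊗ₖ (-((4 * (Real.sqrt 3 : ℂ)⁻¹) • σy)) =
      -((4 * (Real.sqrt 3 : ℂ)⁻¹) • (σy ⊗ₖ σy)) := by
    rw [← neg_smul, kronecker_smul, neg_smul]
  rw [EBIop, hx, hy, hz, hneg, kronecker_smul, kronecker_smul]
  module

theorem trace_EBIop : EBIop.trace = 0 := by
  rw [EBIop_eq]
  simp [trace_kronecker, trace_fin_two, σx, σy, σz]

theorem trace_ρAB_mul_EBIop : (ρAB * EBIop).trace = ((4 * Real.sqrt 3 : ℝ) : ℂ) := by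
  have h3 : (Real.sqrt 3 : ℂ) ^ 2 = 3 := by
    rw [← Complex.ofReal_pow, Real.sq_sqrt (by norm_num)]
    norm_num
  have h0 : (Real.sqrt 3 : ℂ) ≠ 0 := by
    intro h
    simp [h] at h3
  rw [EBIop_eq, ρAB]
  simp only [Matrix.smul_mul, Matrix.mul_smul, Matrix.add_mul, Matrix.sub_mul,
    Matrix.mul_add, Matrix.mul_sub, ← mul_kronecker_mul,
    trace_smul, trace_add, trace_sub, trace_kronecker, trace_fin_two]
  simp [σx, σy, σz]
  field_simp
  rw [h3]
  norm_num

theorem trace_σv_mul_EBIop (p v : ℝ) :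
    (σv p v * EBIop).trace = ((4 * Real.sqrt 3 * p * v : ℝ) : ℂ) := by
  simp only [σv, Matrix.add_mul, Matrix.smul_mul, Matrix.one_mul, trace_add, trace_smul, trace_EBIop,
    trace_ρAB_mul_EBIop, smul_eq_mul]
  push_cast
  ring

theorem trace_σv_mul_EBIop_le_four_iff (p v : ℝ) :
    (σv p v * EBIop).trace ≤ (4 : ℂ) ↔ p * v ≤ (Real.sqrt 3)⁻¹ := by
  have h0 : 0 < Real.sqrt 3 := by positivity
  rw [trace_σv_mul_EBIop, show (4 : ℂ) = ((4 : ℝ) : ℂ) by norm_num, Complex.real_le_real,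
    ← one_div, le_div_iff₀ h0]
  constructor <;> intro h <;> linarith

/-- The EBI value of the white-noise mixture is `4√3·p·v`; it obeys the
noncontextual bound `4` iff `p·v ≤ 1/√3`; and for `p > 1/√3` the largest
admissible visibility is `1/(√3·p)`, so the white-noise robustness of the
post-channel state is `1 − 1/(√3·p)`. -/
theorem white_noise_robustness_depolarizing (p v : ℝ)
    (hp0 : 0 ≤ p) (hp1 : p ≤ 1) (hv0 : 0 ≤ v) (hv1 : v ≤ 1) :
    ((σv p v * EBIop).trace = ((4 * Real.sqrt 3 * p * v : ℝ) : ℂ)) ∧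
    ((σv p v * EBIop).trace ≤ (4 : ℂ) ↔ p * v ≤ (Real.sqrt 3)⁻¹) ∧
    ((Real.sqrt 3)⁻¹ < p →
      (IsGreatest {v' : ℝ | v' ∈ Set.Icc (0 : ℝ) 1 ∧
          (σv p v' * EBIop).trace ≤ (4 : ℂ)} (1 / (Real.sqrt 3 * p)) ∧
        1 - 4 / ((σv p 1 * EBIop).trace.re) = 1 - 1 / (Real.sqrt 3 * p))) := by
  refine ⟨trace_σv_mul_EBIop p v, trace_σv_mul_EBIop_le_four_iff p v, fun hp => ?_⟩
  have h0 : 0 < Real.sqrt 3 := by positivity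
  have hpos : 0 < p := lt_trans (by positivity) hp
  have hsp : 1 < Real.sqrt 3 * p := by
    rwa [inv_lt_iff_one_lt_mul₀' h0] at hp
  refine ⟨⟨⟨⟨by positivity, ?_⟩, ?_⟩, fun w hw => ?_⟩, ?_⟩
  · rw [div_le_one (by positivity)]
    exact hsp.le
  · rw [trace_σv_mul_EBIop_le_four_iff]
    apply le_of_eq
    field_simp
  · have h := (trace_σv_mul_EBIop_le_four_iff p w).1 hw.2
    rw [← one_div, le_div_iff₀ h0] at h
    rw [le_div_iff₀ (by positivity)]
    linarith
  · rw [trace_σv_mul_EBIop, Complex.ofReal_re]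
    field_simp
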